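/- Suppose the bitstrings l₁, …, lₙ are pairwise distinct and lₙ is the all-zeros bitstring. Suppose g₁, …, g_{k′} with k′ ≤ 2n − 1 are permutations of S, each equal to X j or Y i for some i, j ∈ I, such that in the configuration (g_{k′} ⋯ g₁ · t)(C₀) the top face is monochromatic (the map sending each (c, r) ∈ I × I to ε₁ + ε₂, where (g_{k′} ⋯ g₁ · t)⁻¹(c, r, (0, 0)) = (c′, r′, (ε₁, ε₂)), is constant). Let i₁ ≠ i₂ ∈ {1, …, n} and let α < β in {1, …, k′} be such that g_α is the unique member of the sequence lying in {Y i₁, Y (−i₁)} and g_β is the unique member lying in {Y i₂, Y (−i₂)}. Then the number of indices j with α < j < β such that g_j is a column move (g_j = X c for some c ∈ I) is at least the Hamming distance between l_{i₁} and l_{i₂}. -/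

import Mathlib

namespace RSq

def I (h : ℕ) : Type := {i : ℤ // i ≠ 0 ∧ |i| ≤ (h : ℤ)}

instance (h : ℕ) : DecidableEq (I h) :=
  inferInstanceAs (DecidableEq {i : ℤ // i ≠ 0 ∧ |i| ≤ (h : ℤ)})

instance (h : ℕ) : Neg (I h) :=
  ⟨fun i => ⟨-i.1, neg_ne_zero.mpr i.2.1, by rw [abs_neg]; exact i.2.2⟩⟩

@[simp] theorem I.neg_neg {h : ℕ} (i : I h) : -(-i) = i :=
  Subtype.ext (by show -(-i.1) = i.1; exact _root_.neg_neg i.1)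

abbrev S (h : ℕ) : Type := I h × I h × (ZMod 2 × ZMod 2)

@[simp] theorem zmod2_add_one_one (ε : ZMod 2) : ε + 1 + 1 = ε := by revert ε; decide

/-- Column move: flips column `j`. -/
def X {h : ℕ} (j : I h) : Equiv.Perm (S h) :=
  Function.Involutive.toPerm
    (fun s => if s.1 = j then (s.1, -s.2.1, (s.2.2.1 + 1, s.2.2.2)) else s)
    (by
      rintro ⟨c, r, ε₁, ε₂⟩
      by_cases hc : c = j <;> simp [hc])

/-- Row move: flips row `i`. -/
def Y {h : ℕ} (i : I h) : Equiv.Perm (S h) :=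
  Function.Involutive.toPerm
    (fun s => if s.2.1 = i then (-s.1, s.2.1, (s.2.2.1, s.2.2.2 + 1)) else s)
    (by
      rintro ⟨c, r, ε₁, ε₂⟩
      by_cases hr : r = i <;> simp [hr])

/-- The side-length parameter: `h = max m n + 2n`. -/
abbrev hS (n m : ℕ) : ℕ := max m n + 2 * n

def bit {m : ℕ} (w : Fin m → Bool) (c : ℤ) : Bool :=
  if hc : 1 ≤ c ∧ c ≤ (m : ℤ) then w ⟨(c - 1).toNat, by omega⟩ else false

def colIdx {n m : ℕ} (j : Fin m) : I (hS n m) :=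
  ⟨((j : ℕ) : ℤ) + 1, by
    have hj : (j : ℕ) < m := j.isLt
    have hm : m ≤ hS n m := le_trans (le_max_left m n) (Nat.le_add_right _ _)
    constructor
    · omega
    · rw [abs_of_nonneg (by omega)]; omega⟩

def rowIdx {n m : ℕ} (i : Fin n) : I (hS n m) :=
  ⟨((i : ℕ) : ℤ) + 1, by
    have hi : (i : ℕ) < n := i.isLt
    have hn : n ≤ hS n m := le_trans (le_max_right m n) (Nat.le_add_right _ _)
    constructor
    · omega
    · rw [abs_of_nonneg (by omega)]; omega⟩

/-- `aᵢ := (X 1)^{lᵢ(1)} ⋯ (X m)^{lᵢ(m)}`. -/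
def a {n m : ℕ} (l : Fin n → Fin m → Bool) (i : Fin n) : Equiv.Perm (S (hS n m)) :=
  ((List.finRange m).map (fun j => X (colIdx (n := n) j) ^ (if l i j then 1 else 0))).prod

/-- `bᵢ := aᵢ⁻¹ · (Y i) · aᵢ`. -/
def b {n m : ℕ} (l : Fin n → Fin m → Bool) (i : Fin n) : Equiv.Perm (S (hS n m)) :=
  (a l i)⁻¹ * Y (rowIdx (m := m) i) * a l i

/-- `t := a₁ · b₁ · b₂ ⋯ bₙ`. -/
def t {n m : ℕ} (hn : 0 < n) (l : Fin n → Fin m → Bool) : Equiv.Perm (S (hS n m)) :=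
  a l ⟨0, hn⟩ * ((List.finRange n).map (b l)).prod


section Moves

variable {h : ℕ}

theorem I.neg_ne (i : I h) : -i ≠ i := by
  intro e
  have h1 : -i.1 = i.1 := congrArg Subtype.val e
  have := i.2.1
  omega

theorem X_apply (j : I h) (s : S h) :
    X j s = if s.1 = j then (s.1, -s.2.1, (s.2.2.1 + 1, s.2.2.2)) else s := rfl

theorem Y_apply (i : I h) (s : S h) :
    Y i s = if s.2.1 = i then (-s.1, s.2.1, (s.2.2.1, s.2.2.2 + 1)) else s := rfl

theorem X_ne_Y (j i : I h) : (X j : Equiv.Perm (S h)) ≠ Y i := by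
  intro e
  have := congrArg (fun f : Equiv.Perm (S h) => (f (j, i, (0, 0))).2.2.1) e
  simp [X_apply, Y_apply] at this

theorem Y_injective : Function.Injective (Y : I h → Equiv.Perm (S h)) := fun i i' e => by
  by_contra hne
  have := congrArg (fun f : Equiv.Perm (S h) => (f (i, i, (0, 0))).2.2.2) e
  simp [Y_apply, hne] at this

/-- The move encoded by a column index (left) or a row index (right). -/
def move : I h ⊕ I h → Equiv.Perm (S h) := Sum.elim X Y

/-- The states of the four cubies lying in columns `±c` and rows `±r`: the first two entries tell
whether the column is `c` and whether the row is `r`. -/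
abbrev Quad : Type := Bool × Bool × (ZMod 2 × ZMod 2)

/-- Flip of the column `c` (for `s = true`) or `-c` (for `s = false`). -/
def quadX (s : Bool) : Equiv.Perm Quad :=
  Function.Involutive.toPerm
    (fun x => if x.1 = s then (x.1, !x.2.1, (x.2.2.1 + 1, x.2.2.2)) else x)
    (by revert s; unfold Function.Involutive; decide)

/-- Flip of the row `r` (for `s = true`) or `-r` (for `s = false`). -/
def quadY (s : Bool) : Equiv.Perm Quad :=
  Function.Involutive.toPerm
    (fun x => if x.2.1 = s then (!x.1, x.2.1, (x.2.2.1, x.2.2.2 + 1)) else x)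
    (by revert s; unfold Function.Involutive; decide)

theorem quadX_apply (s : Bool) (x : Quad) :
    quadX s x = if x.1 = s then (x.1, !x.2.1, (x.2.2.1 + 1, x.2.2.2)) else x := rfl

theorem quadY_apply (s : Bool) (x : Quad) :
    quadY s x = if x.2.1 = s then (!x.1, x.2.1, (x.2.2.1, x.2.2.2 + 1)) else x := rfl

theorem quadX_sq (s : Bool) : quadX s ^ 2 = 1 := by revert s; decide

theorem quadX_comm : Commute (quadX true) (quadX false) := by
  unfold Commute SemiconjBy; decide

/-- `±c` according to a sign. -/
def signed (c : I h) (s : Bool) : I h := if s then c else -c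

theorem signed_not (c : I h) (s : Bool) : signed c (!s) = -signed c s := by
  cases s <;> simp [signed]

theorem signed_inj (c : I h) {s s' : Bool} : signed c s = signed c s' ↔ s = s' := by
  have h1 := I.neg_ne c
  have h2 := h1.symm
  cases s <;> cases s' <;> simp [signed, h1, h2]

/-- Inclusion of the four cubies in columns `±c` and rows `±r`. -/
def quad (c r : I h) (x : Quad) : S h := (signed c x.1, signed r x.2.1, x.2.2)

/-- `g` restricts to `d` on the cubies in columns `±c` and rows `±r`. -/
def Restricts (c r : I h) (g : Equiv.Perm (S h)) (d : Equiv.Perm Quad) : Prop :=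
  ∀ x, g (quad c r x) = quad c r (d x)

namespace Restricts

variable {c r : I h} {g g' : Equiv.Perm (S h)} {d d' : Equiv.Perm Quad}

theorem one : Restricts c r 1 1 := fun _ => rfl

theorem mul (hg : Restricts c r g d) (hg' : Restricts c r g' d') :
    Restricts c r (g * g') (d * d') := fun x => by
  rw [Equiv.Perm.mul_apply, hg', hg, Equiv.Perm.mul_apply]

theorem inv (hg : Restricts c r g d) : Restricts c r g⁻¹ d⁻¹ := fun x => by
  rw [Equiv.Perm.inv_eq_iff_eq, hg, ← Equiv.Perm.mul_apply, mul_inv_cancel, Equiv.Perm.one_apply]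

theorem pow (hg : Restricts c r g d) (k : ℕ) : Restricts c r (g ^ k) (d ^ k) := by
  induction k with
  | zero => exact one
  | succ k ih => rw [pow_succ, pow_succ]; exact ih.mul hg

theorem list_prod_pow {ι : Type*} (L : List ι) (f : ι → Equiv.Perm (S h)) (e : ι → ℕ)
    (hf : ∀ x, Restricts c r (f x) (d ^ e x)) :
    Restricts c r (L.map f).prod (d ^ (L.map e).sum) := by
  induction L with
  | nil => exact one
  | cons x L ih =>
    rw [List.map_cons, List.map_cons, List.prod_cons, List.sum_cons, pow_add]
    exact (hf x).mul ih

theorem X_signed (c r : I h) (s : Bool) : Restricts c r (X (signed c s)) (quadX s) := by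
  rintro ⟨x, y, e⟩
  by_cases hx : x = s
  · simp [X_apply, quadX_apply, quad, hx, signed_not]
  · simp [X_apply, quadX_apply, quad, hx, signed_inj]

theorem Y_signed (c r : I h) (s : Bool) : Restricts c r (Y (signed r s)) (quadY s) := by
  rintro ⟨x, y, e⟩
  by_cases hy : y = s
  · simp [Y_apply, quadY_apply, quad, hy, signed_not]
  · simp [Y_apply, quadY_apply, quad, hy, signed_inj]

theorem X_of_ne {j : I h} (hj : ∀ s, j ≠ signed c s) : Restricts c r (X j) 1 := by
  rintro ⟨x, y, e⟩
  simp [X_apply, quad, (hj x).symm]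

theorem Y_of_ne {i : I h} (hi : ∀ s, i ≠ signed r s) : Restricts c r (Y i) 1 := by
  rintro ⟨x, y, e⟩
  simp [Y_apply, quad, (hi y).symm]

/-- A sequence of moves none of which flips the rows `±r`. -/
theorem moves (W : List (I h ⊕ I h)) (hW : ∀ s, Sum.inr (signed r s) ∉ W) :
    Restricts c r (W.map move).reverse.prod
      (quadX true ^ W.countP (· = Sum.inl (signed c true)) *
        quadX false ^ W.countP (· = Sum.inl (signed c false))) := by
  induction W with
  | nil => exact one
  | cons w W ih =>
    have ih' := ih fun s hs => hW s (List.mem_cons_of_mem _ hs)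
    rw [List.map_cons, List.reverse_cons, List.prod_append, List.prod_singleton]
    have hw : ∀ s, w ≠ Sum.inr (signed r s) := fun s e => hW s (by simp [e])
    by_cases h1 : w = Sum.inl (signed c true)
    · have := ih'.mul (X_signed c r true)
      rw [mul_assoc, ((quadX_comm.pow_right _).symm).eq, ← mul_assoc, ← pow_succ] at this
      simpa [h1, move, signed_inj, List.countP_cons] using this
    by_cases h2 : w = Sum.inl (signed c false)
    · have := ih'.mul (X_signed c r false)
      rw [mul_assoc, ← pow_succ] at this
      simpa [h2, move, signed_inj, List.countP_cons] using this
    rw [List.countP_cons_of_neg (by simpa using h1), List.countP_cons_of_neg (by simpa using h2)]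
    have : Restricts c r (move w) 1 := by
      rcases w with j | i
      · refine X_of_ne fun s e => ?_
        cases s
        · exact h2 (by rw [e])
        · exact h1 (by rw [e])
      · exact Y_of_ne fun s e => hw s (by rw [e])
    simpa using ih'.mul this

end Restricts

/-- Every cubie of the quadruple shows colour `v` after applying `d` to the solved state. -/
def Shows (v : ZMod 2) (d : Equiv.Perm Quad) : Prop :=
  ∀ x y : Bool, (d⁻¹ (x, y, (0, 0))).2.2.1 + (d⁻¹ (x, y, (0, 0))).2.2.2 = v

instance (v : ZMod 2) (d : Equiv.Perm Quad) : Decidable (Shows v d) := by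
  unfold Shows; infer_instance

theorem Restricts.shows {c r : I h} {g : Equiv.Perm (S h)} {d : Equiv.Perm Quad} {v : ZMod 2}
    (hg : Restricts c r g d)
    (hv : ∀ c r : I h, (g⁻¹ (c, r, ((0 : ZMod 2), (0 : ZMod 2)))).2.2.1 +
      (g⁻¹ (c, r, ((0 : ZMod 2), (0 : ZMod 2)))).2.2.2 = v) : Shows v d := by
  intro x y
  have h1 := hv (signed c x) (signed r y)
  have h2 : g⁻¹ (signed c x, signed r y, (0, 0)) = _ := hg.inv (x, y, (0, 0))
  rw [h2] at h1
  exact h1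

theorem quadX_pow_bodd (s : Bool) (k : ℕ) : quadX s ^ k = quadX s ^ k.bodd.toNat := by
  conv_lhs => rw [← Nat.bodd_add_div2 k]
  rw [pow_add, pow_mul, quadX_sq, one_pow, mul_one]

theorem sign_eq_true_of_shows : ∀ s : Bool, Shows 0 (quadY s * quadY true) → s = true := by
  decide

theorem eq_zero_of_shows_one : ∀ v : ZMod 2, Shows v 1 → v = 0 := by decide

theorem bxor_eq_of_shows_bool : ∀ p p' q q' k e : Bool,
    Shows 0 (quadX true ^ (p ^^ p').toNat * quadX false ^ (q ^^ q').toNat *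
      quadX true ^ k.toNat) →
    Shows 0 (quadX true ^ p'.toNat * quadX false ^ q'.toNat * quadY true *
      (quadX true ^ p.toNat * quadX false ^ q.toNat) * (quadX true ^ k.toNat *
        ((quadX true ^ e.toNat)⁻¹ * quadY true * quadX true ^ e.toNat))) →
    (p' ^^ q') = e := by
  decide +kernel

theorem bodd_eq_of_shows (p p' q q' k e : ℕ)
    (h₁ : Shows 0 (quadX true ^ (p + p') * quadX false ^ (q + q') * quadX true ^ k))
    (h₂ : Shows 0 (quadX true ^ p' * quadX false ^ q' * quadY true *
      (quadX true ^ p * quadX false ^ q) * (quadX true ^ k *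
        ((quadX true ^ e)⁻¹ * quadY true * quadX true ^ e)))) :
    (p' + q').bodd = e.bodd := by
  rw [Nat.bodd_add]
  refine bxor_eq_of_shows_bool p.bodd p'.bodd q.bodd q'.bodd k.bodd e.bodd ?_ ?_
  · rw [← Nat.bodd_add, ← Nat.bodd_add, ← quadX_pow_bodd, ← quadX_pow_bodd, ← quadX_pow_bodd]
    exact h₁
  · simp only [← quadX_pow_bodd]
    exact h₂

end Moves

theorem exists_ofFn_eq {γ : Type*} {k : ℕ} (f : Fin k → γ) (x y : Fin k) (hxy : x < y) :
    ∃ A B C : List γ, List.ofFn f = A ++ f x :: (B ++ f y :: C) ∧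
      (∀ w ∈ A, ∃ q, q < x ∧ f q = w) ∧ (∀ w ∈ B, ∃ q, x < q ∧ q < y ∧ f q = w) ∧
      (∀ w ∈ C, ∃ q, y < q ∧ f q = w) := by
  obtain ⟨x, hx⟩ := x
  obtain ⟨y, hy⟩ := y
  have hxy' : x < y := hxy
  refine ⟨(List.ofFn f).take x, ((List.ofFn f).drop (x + 1)).take (y - (x + 1)),
    (List.ofFn f).drop (y + 1), ?_, ?_, ?_, ?_⟩
  · have h1 : (List.ofFn f).drop y = f ⟨y, hy⟩ :: (List.ofFn f).drop (y + 1) := by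
      rw [List.drop_eq_getElem_cons (by simpa using hy), List.getElem_ofFn]
    have h2 : (List.ofFn f).drop x = f ⟨x, hx⟩ :: (List.ofFn f).drop (x + 1) := by
      rw [List.drop_eq_getElem_cons (by simpa using hx), List.getElem_ofFn]
    have h3 : (List.ofFn f).drop y = ((List.ofFn f).drop (x + 1)).drop (y - (x + 1)) := by
      rw [List.drop_drop]; congr 1; omega
    rw [← h1, h3, List.take_append_drop, ← h2, List.take_append_drop]
  · intro w hw
    obtain ⟨q, hq, rfl⟩ := List.mem_iff_getElem.1 hw
    rw [List.length_take, List.length_ofFn] at hq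
    refine ⟨⟨q, by omega⟩, Fin.mk_lt_mk.2 (by omega), ?_⟩
    simp
  · intro w hw
    obtain ⟨q, hq, rfl⟩ := List.mem_iff_getElem.1 hw
    rw [List.length_take, List.length_drop, List.length_ofFn] at hq
    refine ⟨⟨x + 1 + q, by omega⟩, Fin.mk_lt_mk.2 (by omega), Fin.mk_lt_mk.2 (by omega), ?_⟩
    simp
  · intro w hw
    obtain ⟨q, hq, rfl⟩ := List.mem_iff_getElem.1 hw
    rw [List.length_drop, List.length_ofFn] at hq
    refine ⟨⟨y + 1 + q, by omega⟩, Fin.mk_lt_mk.2 (by omega), ?_⟩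
    simp

section Configuration

variable {n m : ℕ}

theorem colIdx_injective : Function.Injective (colIdx (n := n) (m := m)) := fun j j' e => by
  have : ((j : ℕ) : ℤ) + 1 = ((j' : ℕ) : ℤ) + 1 := congrArg Subtype.val e
  exact Fin.ext (by omega)

theorem rowIdx_injective : Function.Injective (rowIdx (n := n) (m := m)) := fun i i' e => by
  have : ((i : ℕ) : ℤ) + 1 = ((i' : ℕ) : ℤ) + 1 := congrArg Subtype.val e
  exact Fin.ext (by omega)

theorem colIdx_pos (j : Fin m) : 0 < (colIdx (n := n) j).1 := by
  show (0 : ℤ) < ((j : ℕ) : ℤ) + 1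
  omega

theorem rowIdx_pos (i : Fin n) : 0 < (rowIdx (m := m) i).1 := by
  show (0 : ℤ) < ((i : ℕ) : ℤ) + 1
  omega

theorem ne_signed_of_pos {h : ℕ} {j c : I h} (hj : 0 < j.1) (hc : 0 < c.1) (hne : j ≠ c)
    (s : Bool) : j ≠ signed c s := by
  cases s
  · intro e
    have : j.1 = -c.1 := congrArg Subtype.val e
    omega
  · exact hne

theorem signed_eq_of_pos {h : ℕ} {j c : I h} (hj : 0 < j.1) (hc : 0 < c.1) {s s' : Bool}
    (e : signed j s = signed c s') : j = c := by
  by_contra hne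
  have h1 := congrArg Subtype.val e
  have h2 : j.1 ≠ c.1 := fun e' => hne (Subtype.ext e')
  have hneg : ∀ x : I h, (-x).1 = -x.1 := fun _ => rfl
  cases s <;> cases s' <;> simp [signed, hneg] at h1 <;> omega

/-- The exponent of `X c` in `a l i`. -/
def colExp (l : Fin n → Fin m → Bool) (i : Fin n) (c : I (hS n m)) : ℕ :=
  ∑ j : Fin m, if colIdx j = c then (if l i j then 1 else 0) else 0

theorem colExp_colIdx (l : Fin n → Fin m → Bool) (i : Fin n) (j : Fin m) :
    colExp l i (colIdx j) = (l i j).toNat := by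
  simp only [colExp, colIdx_injective.eq_iff, Finset.sum_ite_eq', Finset.mem_univ, if_true]
  cases l i j <;> rfl

theorem colExp_of_lt (l : Fin n → Fin m → Bool) (i : Fin n) {c : I (hS n m)}
    (hc : (m : ℤ) < c.1) : colExp l i c = 0 := by
  refine Finset.sum_eq_zero fun j _ => if_neg fun e => ?_
  have : ((j : ℕ) : ℤ) + 1 = c.1 := congrArg Subtype.val e
  omega

theorem Restricts.a (l : Fin n → Fin m → Bool) (i : Fin n) {c : I (hS n m)} (hc : 0 < c.1)
    (r : I (hS n m)) : Restricts c r (a l i) (quadX true ^ colExp l i c) := by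
  rw [colExp, Fin.sum_univ_def]
  refine Restricts.list_prod_pow _ _ _ fun j => ?_
  by_cases hj : colIdx j = c
  · rw [if_pos hj, hj]
    exact (Restricts.X_signed c r true).pow _
  · have := (Restricts.X_of_ne (r := r) (ne_signed_of_pos (colIdx_pos j) hc hj)).pow
      (if l i j then 1 else 0)
    rw [one_pow] at this
    rwa [if_neg hj, pow_zero]

theorem Restricts.t_row (hn : 0 < n) (l : Fin n → Fin m → Bool) {c : I (hS n m)} (hc : 0 < c.1)
    (i : Fin n) : Restricts c (rowIdx i) (t hn l) (quadX true ^ colExp l ⟨0, hn⟩ c *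
      ((quadX true ^ colExp l i c)⁻¹ * quadY true * quadX true ^ colExp l i c)) := by
  have h1 := (Restricts.a l ⟨0, hn⟩ hc (rowIdx i)).mul
    (Restricts.list_prod_pow (List.finRange n) (b l) (fun i' => if i' = i then 1 else 0)
      (d := (quadX true ^ colExp l i c)⁻¹ * quadY true * quadX true ^ colExp l i c) fun i' => ?_)
  · rw [← Fin.sum_univ_def, Finset.sum_ite_eq', if_pos (Finset.mem_univ _), pow_one] at h1
    exact h1
  · have ha := Restricts.a l i' hc (rowIdx i)
    by_cases hi : i' = i
    · subst hi
      rw [if_pos rfl, pow_one]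
      exact (ha.inv.mul (Restricts.Y_signed c (rowIdx i') true)).mul ha
    · rw [if_neg hi, pow_zero]
      have := (ha.inv.mul (Restricts.Y_of_ne (ne_signed_of_pos (rowIdx_pos i') (rowIdx_pos i)
        (rowIdx_injective.ne hi)))).mul ha
      rwa [mul_one, inv_mul_cancel] at this

theorem Restricts.t_of_lt (hn : 0 < n) (l : Fin n → Fin m → Bool) {c r : I (hS n m)}
    (hc : 0 < c.1) (hr : (n : ℤ) < r.1) :
    Restricts c r (t hn l) (quadX true ^ colExp l ⟨0, hn⟩ c) := by
  have h1 := (Restricts.a l ⟨0, hn⟩ hc r).mul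
    (Restricts.list_prod_pow (List.finRange n) (b l) (fun _ => 0) (d := 1) fun i => ?_)
  · rwa [one_pow, mul_one] at h1
  · have ha := Restricts.a l i hc r
    have := (ha.inv.mul (Restricts.Y_of_ne (ne_signed_of_pos (rowIdx_pos i) (by omega)
      fun e => ?_))).mul ha
    · rwa [mul_one, inv_mul_cancel] at this
    · have h2 : ((i : ℕ) : ℤ) + 1 = r.1 := congrArg Subtype.val e
      omega

/-- The number of flips of the columns `±c` in a sequence of moves. -/
def flips {h : ℕ} (W : List (I h ⊕ I h)) (c : I h) : ℕ :=
  W.countP (· = Sum.inl (signed c true)) + W.countP (· = Sum.inl (signed c false))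

/-- After the only flip of the rows `±i`, the columns `±j` are flipped `l i j` times mod `2`. -/
theorem bodd_flips (hn : 0 < n) (l : Fin n → Fin m → Bool)
    {W P Q : List (I (hS n m) ⊕ I (hS n m))} {i : Fin n} {s : Bool}
    (hW : W = P ++ Sum.inr (signed (rowIdx i) s) :: Q)
    (hP : ∀ s', Sum.inr (signed (rowIdx i) s') ∉ P)
    (hQ : ∀ s', Sum.inr (signed (rowIdx i) s') ∉ Q)
    {u : I (hS n m)} (hnu : (n : ℤ) < u.1) (hmu : (m : ℤ) < u.1)
    (hu : ∀ s', Sum.inl (signed u s') ∉ W ∧ Sum.inr (signed u s') ∉ W) {v : ZMod 2}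
    (hv : ∀ c r : I (hS n m),
      (((W.map move).reverse.prod * t hn l)⁻¹ (c, r, ((0 : ZMod 2), (0 : ZMod 2)))).2.2.1 +
      (((W.map move).reverse.prod * t hn l)⁻¹ (c, r, ((0 : ZMod 2), (0 : ZMod 2)))).2.2.2 = v)
    (j : Fin m) : (flips Q (colIdx j)).bodd = l i j := by
  have hu0 : 0 < u.1 := by omega
  have count_eq_zero : ∀ V : List (I (hS n m) ⊕ I (hS n m)), V ⊆ W → ∀ s',
      V.countP (· = Sum.inl (signed u s')) = 0 := fun V hV s' =>
    List.countP_eq_zero.2 fun w hw e => (hu s').1 (of_decide_eq_true e ▸ hV hw)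
  have hPW : P ⊆ W := fun w hw => by simp [hW, hw]
  have hQW : Q ⊆ W := fun w hw => by simp [hW, hw]
  have restricts_row : ∀ {c : I (hS n m)}, 0 < c.1 → _ := fun {c} hc =>
    ((((Restricts.moves (c := c) Q hQ).mul (Restricts.Y_signed c (rowIdx i) s)).mul
      (Restricts.moves P hP)).mul (Restricts.t_row hn l hc i))
  have hprod : (W.map move).reverse.prod = (Q.map move).reverse.prod *
      Y (signed (rowIdx i) s) * (P.map move).reverse.prod := by
    simp [hW, move, mul_assoc]
  obtain rfl : v = 0 := by
    have := ((Restricts.moves (c := u) W fun s' => (hu s').2).mul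
      (Restricts.t_of_lt hn l hu0 hnu)).shows hv
    rw [count_eq_zero W (List.Subset.refl _), count_eq_zero W (List.Subset.refl _),
      colExp_of_lt l _ hmu] at this
    exact eq_zero_of_shows_one v (by simpa using this)
  obtain rfl : s = true := by
    have := restricts_row hu0
    rw [← hprod] at this
    have := this.shows hv
    simp only [count_eq_zero Q hQW, count_eq_zero P hPW, colExp_of_lt l _ hmu] at this
    exact sign_eq_true_of_shows s (by simpa using this)
  have h₁ := ((Restricts.moves W fun s' => (hu s').2).mul
    (Restricts.t_of_lt hn l (colIdx_pos j) hnu)).shows hv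
  have h₂ := restricts_row (colIdx_pos j)
  rw [← hprod] at h₂
  have h₂ := h₂.shows hv
  have hcount : ∀ s', W.countP (· = Sum.inl (signed (colIdx j) s')) =
      P.countP (· = Sum.inl (signed (colIdx j) s')) +
      Q.countP (· = Sum.inl (signed (colIdx j) s')) := fun s' => by
    simp [hW]
  rw [hcount, hcount] at h₁
  have := bodd_eq_of_shows _ _ _ _ _ _ h₁ h₂
  rw [flips, this, colExp_colIdx]
  cases l i j <;> rfl

/-- Fewer than `2n` moves miss some pair of columns and rows `±u` beyond `max m n`. -/
theorem exists_unmoved {k : ℕ} (hk : k < 2 * n) (f : Fin k → I (hS n m) ⊕ I (hS n m)) :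
    ∃ u : I (hS n m), (n : ℤ) < u.1 ∧ (m : ℤ) < u.1 ∧
      ∀ s q, f q ≠ Sum.inl (signed u s) ∧ f q ≠ Sum.inr (signed u s) := by
  let size : I (hS n m) ⊕ I (hS n m) → ℤ := Sum.elim (fun c => |c.1|) (fun r => |r.1|)
  obtain ⟨x, hx, hx'⟩ := Finset.exists_mem_notMem_of_card_lt_card
    (s := Finset.univ.image fun q => size (f q))
    (t := Finset.Ioc ((max m n : ℕ) : ℤ) ((hS n m : ℕ) : ℤ)) (by
      refine lt_of_le_of_lt Finset.card_image_le ?_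
      simp only [Finset.card_univ, Fintype.card_fin, Int.card_Ioc, hS]
      omega)
  rw [Finset.mem_Ioc] at hx
  have hx0 : 0 < x := by omega
  have abs_signed : ∀ (u : I (hS n m)) (s : Bool), |(signed u s).1| = |u.1| := fun u s => by
    cases s
    · exact abs_neg _
    · rfl
  refine ⟨⟨x, hx0.ne', by rw [abs_of_pos hx0]; exact hx.2⟩, by show (n : ℤ) < x; omega,
    by show (m : ℤ) < x; omega, fun s q => ?_⟩
  have hne : size (f q) ≠ x := fun e => hx' (Finset.mem_image.2 ⟨q, Finset.mem_univ _, e⟩)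
  constructor <;> intro e <;> refine hne ?_ <;> rw [e] <;>
    exact (abs_signed _ s).trans (abs_of_pos hx0)

end Configuration

/-- the number of column moves between the unique `Y i₁`-type and
`Y i₂`-type moves is at least the Hamming distance of `l i₁` and `l i₂`. -/
theorem stmt_7 (n m : ℕ) (hn : 0 < n) (hm : 0 < m) (l : Fin n → Fin m → Bool)
    (hdist : Function.Injective l)
    (hlast : l ⟨n - 1, by omega⟩ = fun _ => false)
    (k' : ℕ) (hk : k' ≤ 2 * n - 1) (g : Fin k' → Equiv.Perm (S (hS n m)))
    (hmoves : ∀ q, (∃ j, g q = X j) ∨ (∃ i, g q = Y i))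
    (hmono : ∃ v : ZMod 2, ∀ c r : I (hS n m),
      (((List.ofFn g).reverse.prod * t hn l)⁻¹
          (c, r, ((0 : ZMod 2), (0 : ZMod 2)))).2.2.1 +
        (((List.ofFn g).reverse.prod * t hn l)⁻¹
          (c, r, ((0 : ZMod 2), (0 : ZMod 2)))).2.2.2 = v)
    (i₁ i₂ : Fin n) (hne : i₁ ≠ i₂) (α β : Fin k') (hαβ : α < β)
    (hα : g α = Y (rowIdx (m := m) i₁) ∨ g α = Y (-(rowIdx (m := m) i₁)))
    (hαu : ∀ q, g q = Y (rowIdx (m := m) i₁) ∨ g q = Y (-(rowIdx (m := m) i₁)) → q = α)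
    (hβ : g β = Y (rowIdx (m := m) i₂) ∨ g β = Y (-(rowIdx (m := m) i₂)))
    (hβu : ∀ q, g q = Y (rowIdx (m := m) i₂) ∨ g q = Y (-(rowIdx (m := m) i₂)) → q = β) :
    hammingDist (l i₁) (l i₂) ≤
      Nat.card {q : Fin k' // α < q ∧ q < β ∧ ∃ c, g q = X c} := by
  have hmove : ∀ q, ∃ w, move w = g q := fun q => by
    rcases hmoves q with ⟨j, hj⟩ | ⟨i, hi⟩
    · exact ⟨Sum.inl j, hj.symm⟩
    · exact ⟨Sum.inr i, hi.symm⟩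
  choose f hf using hmove
  have hrow : ∀ q (i : Fin n), g q = Y (rowIdx (m := m) i) ∨ g q = Y (-(rowIdx (m := m) i)) →
      ∃ s, f q = Sum.inr (signed (rowIdx i) s) := by
    intro q i hq
    rw [← hf q] at hq
    rcases hw : f q with j | i' <;> rw [hw] at hq
    · exact (hq.elim (X_ne_Y _ _) (X_ne_Y _ _)).elim
    · rcases hq with hq | hq
      · exact ⟨true, congrArg Sum.inr (Y_injective hq)⟩
      · exact ⟨false, congrArg Sum.inr (Y_injective hq)⟩
  obtain ⟨sα, hfα⟩ := hrow α i₁ hα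
  obtain ⟨sβ, hfβ⟩ := hrow β i₂ hβ
  have hinr : ∀ {q : Fin k'} {i : Fin n} {s : Bool}, f q = Sum.inr (signed (rowIdx i) s) →
      g q = Y (rowIdx (m := m) i) ∨ g q = Y (-(rowIdx (m := m) i)) := by
    intro q i s e
    rw [← hf q, e]
    cases s
    · exact Or.inr rfl
    · exact Or.inl rfl
  obtain ⟨u, hnu, hmu, hu⟩ := exists_unmoved (n := n) (m := m) (by omega) f
  obtain ⟨v, hv⟩ := hmono
  obtain ⟨A, B, C, hW, hA, hB, hC⟩ := exists_ofFn_eq f α β hαβ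
  have hg : List.ofFn g = (List.ofFn f).map move := by
    rw [List.map_ofFn]
    exact congrArg List.ofFn (funext fun q => (hf q).symm)
  rw [hg] at hv
  have hu' : ∀ s, Sum.inl (signed u s) ∉ List.ofFn f ∧ Sum.inr (signed u s) ∉ List.ofFn f := by
    intro s
    simp only [List.mem_ofFn, not_exists]
    exact ⟨fun q => (hu s q).1, fun q => (hu s q).2⟩
  have hrow_ne : ∀ s s', signed (rowIdx (m := m) i₁) s ≠ signed (rowIdx i₂) s' := fun s s' e =>
    hne (rowIdx_injective (signed_eq_of_pos (rowIdx_pos i₁) (rowIdx_pos i₂) e))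
  have hA₁ : ∀ s, Sum.inr (signed (rowIdx i₁) s) ∉ A := fun s hs => by
    obtain ⟨q, hq, e⟩ := hA _ hs
    exact hq.ne (hαu q (hinr e))
  have hA₂ : ∀ s, Sum.inr (signed (rowIdx i₂) s) ∉ A := fun s hs => by
    obtain ⟨q, hq, e⟩ := hA _ hs
    exact (hq.trans hαβ).ne (hβu q (hinr e))
  have hB₁ : ∀ s, Sum.inr (signed (rowIdx i₁) s) ∉ B := fun s hs => by
    obtain ⟨q, hq, -, e⟩ := hB _ hs
    exact hq.ne' (hαu q (hinr e))
  have hB₂ : ∀ s, Sum.inr (signed (rowIdx i₂) s) ∉ B := fun s hs => by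
    obtain ⟨q, -, hq, e⟩ := hB _ hs
    exact hq.ne (hβu q (hinr e))
  have hC₁ : ∀ s, Sum.inr (signed (rowIdx i₁) s) ∉ C := fun s hs => by
    obtain ⟨q, hq, e⟩ := hC _ hs
    exact (hαβ.trans hq).ne' (hαu q (hinr e))
  have hC₂ : ∀ s, Sum.inr (signed (rowIdx i₂) s) ∉ C := fun s hs => by
    obtain ⟨q, hq, e⟩ := hC _ hs
    exact hq.ne' (hβu q (hinr e))
  rw [hfα, hfβ] at hW
  have h₁ := bodd_flips hn l hW hA₁
    (fun s => by simp [hB₁ s, hC₁ s, hrow_ne]) hnu hmu hu' hv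
  have h₂ := bodd_flips hn l
    (hW.trans (List.append_assoc A (Sum.inr (signed (rowIdx i₁) sα) :: B) _).symm)
    (fun s => by simp [hA₂ s, hB₂ s, (hrow_ne _ _).symm]) hC₂ hnu hmu hu' hv
  have hex : ∀ j : Fin m, l i₁ j ≠ l i₂ j →
      ∃ q, α < q ∧ q < β ∧ ∃ s, f q = Sum.inl (signed (colIdx j) s) := by
    intro j hj
    by_contra! hno
    have hzero : ∀ s, B.countP (· = Sum.inl (signed (colIdx j) s)) = 0 := fun s =>
      List.countP_eq_zero.2 fun w hw e => by
        obtain ⟨q, h1, h2, h3⟩ := hB w hw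
        exact hno q h1 h2 s (h3.trans (of_decide_eq_true e))
    refine hj ?_
    rw [← h₁ j, ← h₂ j]
    simp [flips, hzero]
  have : Nonempty (Fin k') := ⟨α⟩
  choose! q hq₁ hq₂ s hs using hex
  rw [hammingDist, ← Fintype.card_coe, ← Nat.card_eq_fintype_card]
  refine Nat.card_le_card_of_injective
    (fun j => ⟨q j.1, hq₁ _ (Finset.mem_filter.1 j.2).2, hq₂ _ (Finset.mem_filter.1 j.2).2,
      signed (colIdx j.1) (s j.1), by
        rw [← hf, hs _ (Finset.mem_filter.1 j.2).2]; rfl⟩) fun j j' e => ?_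
  have e' : q j.1 = q j'.1 := congrArg Subtype.val e
  have e₁ := hs _ (Finset.mem_filter.1 j.2).2
  rw [e', hs _ (Finset.mem_filter.1 j'.2).2] at e₁
  exact Subtype.ext (colIdx_injective
    (signed_eq_of_pos (colIdx_pos _) (colIdx_pos _) (Sum.inl.inj e₁))).symm

end RSq
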